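/- Let m = 2k+1 be an odd positive integer with k ≥ 2, let q ∈ [q_f(m), m+1], and let c = (c_i), d = (d_i) ∈ A'_q. If the sequence (c_i + d_i) is lexicographically at least the sequence k(k+1)0^∞ (first term k, second term k+1, all other terms 0), then f_{c,d}(q) > 0. -/

import Mathlib

/-- A sequence of digits has a last nonzero digit. -/
def hasLastNonzero (c : ℕ → ℕ) : Prop := ∃ n, c n ≠ 0 ∧ ∀ i > n, c i = 0

/-- `c` (with `c i` the `(i+1)`-st digit) is a `q`-expansion of `x`
with respect to the digit set `Ω_m = {0,1,…,m}`. -/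
def isExpansion (m : ℕ) (q : ℝ) (x : ℝ) (c : ℕ → ℕ) : Prop :=
  (∀ i, c i ≤ m) ∧ x = ∑' i : ℕ, (c i : ℝ) / q ^ (i + 1)

/-- The set `U_q` of points of `I_q = [0, m/(q-1)]` with a unique `q`-expansion. -/
def Uq (m : ℕ) (q : ℝ) : Set ℝ :=
  {x | x ∈ Set.Icc 0 ((m : ℝ) / (q - 1)) ∧ ∃! c, isExpansion m q x c}

/-- The set `U'_q` of digit sequences that are unique `q`-expansions. -/
def Uq' (m : ℕ) (q : ℝ) : Set (ℕ → ℕ) :=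
  {c | isExpansion m q (∑' i : ℕ, (c i : ℝ) / q ^ (i + 1)) c ∧
       ∀ d, isExpansion m q (∑' i : ℕ, (c i : ℝ) / q ^ (i + 1)) d → d = c}

/-- `B_2(m)`: bases `q ∈ (1, m+1]` for which some `x ∈ I_q` has exactly two
different `q`-expansions. -/
def B2 (m : ℕ) : Set ℝ :=
  {q | q ∈ Set.Ioc 1 ((m : ℝ) + 1) ∧
    ∃ x ∈ Set.Icc (0 : ℝ) ((m : ℝ) / (q - 1)), ∃ a b : ℕ → ℕ,
      a ≠ b ∧ isExpansion m q x a ∧ isExpansion m q x b ∧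
      ∀ c, isExpansion m q x c → c = a ∨ c = b}

/-- Strict lexicographic order on digit sequences. -/
def lexLt (a b : ℕ → ℕ) : Prop := ∃ n, (∀ i < n, a i = b i) ∧ a n < b n

/-- Lexicographic order on digit sequences. -/
def lexLe (a b : ℕ → ℕ) : Prop := lexLt a b ∨ a = b

/-- `a` is the quasi-greedy `q`-expansion of `1`: the lexicographically largest
`q`-expansion of `1` without a last nonzero digit. -/
def isQuasiGreedy (m : ℕ) (q : ℝ) (a : ℕ → ℕ) : Prop :=
  isExpansion m q 1 a ∧ ¬ hasLastNonzero a ∧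
  ∀ b, isExpansion m q 1 b → ¬ hasLastNonzero b → lexLe b a

/-- `A'_q = {(c_i) ∈ U'_q : c_1 < α_1(q)}`. -/
def Aq' (m : ℕ) (q : ℝ) : Set (ℕ → ℕ) :=
  {c | c ∈ Uq' m q ∧ ∀ a, isQuasiGreedy m q a → c 0 < a 0}

/-- `f_{c,d}(t) = (m+1)/t + Σ_{i≥1} (c_i + d_i) t^{-(i+1)} - m/(t-1)`. -/
noncomputable def fcd (m : ℕ) (c d : ℕ → ℕ) (t : ℝ) : ℝ :=
  ((m : ℝ) + 1) / t + (∑' i : ℕ, ((c i : ℝ) + (d i : ℝ)) / t ^ (i + 2)) - (m : ℝ) / (t - 1)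

/-- `x = q_f(m)`: the largest real root of `q³-(k+2)q²+q-(k+1)=0` if `m = 2k+1`,
and of `q²-(k+1)q-k=0` if `m = 2k`. -/
def isQf (m : ℕ) (x : ℝ) : Prop :=
  (∃ k : ℕ, m = 2 * k + 1 ∧
    x ^ 3 - ((k : ℝ) + 2) * x ^ 2 + x - ((k : ℝ) + 1) = 0 ∧
    ∀ y : ℝ, y ^ 3 - ((k : ℝ) + 2) * y ^ 2 + y - ((k : ℝ) + 1) = 0 → y ≤ x) ∨
  (∃ k : ℕ, m = 2 * k ∧
    x ^ 2 - ((k : ℝ) + 1) * x - (k : ℝ) = 0 ∧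
    ∀ y : ℝ, y ^ 2 - ((k : ℝ) + 1) * y - (k : ℝ) = 0 → y ≤ x)

/-- A doubly infinite sequence: neither it nor its reflection has a last nonzero digit. -/
def doublyInfinite (m : ℕ) (c : ℕ → ℕ) : Prop :=
  ¬ hasLastNonzero c ∧ ¬ hasLastNonzero (fun i => m - c i)

/-- `V_q`: points of `I_q` with at most one doubly infinite `q`-expansion. -/
def Vq (m : ℕ) (q : ℝ) : Set ℝ :=
  {x | x ∈ Set.Icc 0 ((m : ℝ) / (q - 1)) ∧
    ∀ a b : ℕ → ℕ, isExpansion m q x a → isExpansion m q x b →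
      doublyInfinite m a → doublyInfinite m b → a = b}

/-- `U = {q ∈ (1, m+1] : 1 ∈ U_q}`. -/
def Uset (m : ℕ) : Set ℝ := {q | q ∈ Set.Ioc 1 ((m : ℝ) + 1) ∧ (1 : ℝ) ∈ Uq m q}

/-- `V = {q ∈ (1, m+1] : 1 ∈ V_q}`. -/
def Vset (m : ℕ) : Set ℝ := {q | q ∈ Set.Ioc 1 ((m : ℝ) + 1) ∧ (1 : ℝ) ∈ Vq m q}

/-- The generalized golden ratio `G(m)`. -/
noncomputable def Gratio (m : ℕ) : ℝ :=
  if m % 2 = 0 then ((m / 2 : ℕ) : ℝ) + 1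
  else (((m / 2 : ℕ) : ℝ) + 1 +
    Real.sqrt (((m / 2 : ℕ) : ℝ) ^ 2 + 6 * ((m / 2 : ℕ) : ℝ) + 5)) / 2

/-- The set of accumulation points of a set of reals. -/
def accPts (S : Set ℝ) : Set ℝ := {x | AccPt x (Filter.principal S)}

/-- Iterated accumulation-point sets `B_2^{(i)}(m)`. -/
def B2iter (m : ℕ) : ℕ → Set ℝ
  | 0 => B2 m
  | n + 1 => accPts (B2iter m n)

/-- The value in base `q` of a digit sequence. -/
noncomputable def digitValue (q : ℝ) (c : ℕ → ℕ) : ℝ := ∑' i : ℕ, (c i : ℝ) / q ^ (i + 1)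

/-- The digit sequence with first digit `a` followed by `e`. -/
def consDigit (a : ℕ) (e : ℕ → ℕ) : ℕ → ℕ
  | 0 => a
  | n + 1 => e n

theorem summable_digits {m : ℕ} {q : ℝ} (hq : 1 < q) {c : ℕ → ℕ} (hc : ∀ i, c i ≤ m) :
    Summable fun i : ℕ => (c i : ℝ) / q ^ (i + 1) := by
  have hq0 : 0 < q := by linarith
  have hgeom : Summable fun i : ℕ => (m : ℝ) * q⁻¹ ^ i :=
    (summable_geometric_of_lt_one (by positivity) (inv_lt_one_of_one_lt₀ hq)).mul_left _
  refine Summable.of_nonneg_of_le (fun i => by positivity) (fun i => ?_) hgeom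
  rw [inv_pow, ← div_eq_mul_inv]
  have h1 : (c i : ℝ) ≤ m := by exact_mod_cast hc i
  have h2 : q ^ i ≤ q ^ (i + 1) := pow_le_pow_right₀ hq.le (Nat.le_succ i)
  gcongr

theorem digitValue_nonneg {q : ℝ} (hq : 1 < q) (c : ℕ → ℕ) : 0 ≤ digitValue q c :=
  tsum_nonneg fun i => by
    have : 0 < q := by linarith
    positivity

theorem digitValue_eq_head_add_tail {m : ℕ} {q : ℝ} (hq : 1 < q) {c : ℕ → ℕ}
    (hc : ∀ i, c i ≤ m) :
    digitValue q c = ((c 0 : ℝ) + digitValue q (fun i => c (i + 1))) / q := by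
  have hq0 : q ≠ 0 := by linarith
  unfold digitValue
  rw [(summable_digits hq hc).tsum_eq_zero_add, add_div, ← tsum_div_const]
  simp only [zero_add, pow_one]
  congr 1
  refine tsum_congr fun i => ?_
  rw [div_div, ← pow_succ]

theorem exists_digit {m : ℕ} {q y : ℝ} (hq : 1 < q) (hqm : q ≤ m + 1)
    (hy : y ∈ Set.Icc 0 ((m : ℝ) / (q - 1))) :
    ∃ a : ℕ, a ≤ m ∧ q * y - a ∈ Set.Icc 0 ((m : ℝ) / (q - 1)) := by
  obtain ⟨hy0, hy1⟩ := hy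
  have hq1 : 0 < q - 1 := by linarith
  have hone : 1 ≤ (m : ℝ) / (q - 1) := by rw [le_div_iff₀ hq1]; linarith
  have hqy : 0 ≤ q * y := by positivity
  by_cases h : ⌊q * y⌋₊ ≤ m
  · refine ⟨⌊q * y⌋₊, h, ?_, ?_⟩
    · linarith [Nat.floor_le hqy]
    · linarith [Nat.lt_floor_add_one (q * y)]
  · refine ⟨m, le_rfl, ?_, ?_⟩
    · have : (m : ℝ) ≤ q * y := (Nat.le_floor_iff hqy).1 (not_le.1 h).le
      linarith
    · rw [le_div_iff₀ hq1] at hy1 ⊢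
      nlinarith

theorem exists_isExpansion {m : ℕ} {q y : ℝ} (hq : 1 < q) (hqm : q ≤ m + 1)
    (hy : y ∈ Set.Icc 0 ((m : ℝ) / (q - 1))) : ∃ e, isExpansion m q y e := by
  have hq0 : 0 < q := by linarith
  choose! digit digit_le digit_mem using
    fun z (hz : z ∈ Set.Icc 0 ((m : ℝ) / (q - 1))) => exists_digit hq hqm hz
  let r : ℕ → ℝ := fun n => (fun z => q * z - digit z)^[n] y
  have r_succ (n : ℕ) : r (n + 1) = q * r n - digit (r n) :=
    Function.iterate_succ_apply' _ _ _
  have r_mem (n : ℕ) : r n ∈ Set.Icc 0 ((m : ℝ) / (q - 1)) := by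
    induction n with
    | zero => exact hy
    | succ n ih => rw [r_succ]; exact digit_mem _ ih
  have partial_sum (n : ℕ) :
      ∑ i ∈ Finset.range n, (digit (r i) : ℝ) / q ^ (i + 1) = y - r n / q ^ n := by
    induction n with
    | zero => simp [r]
    | succ n ih =>
      rw [Finset.sum_range_succ, ih, r_succ]
      field_simp
      ring
  have r_tendsto : Filter.Tendsto (fun n => r n / q ^ n) Filter.atTop (nhds 0) := by
    have hgeom : Filter.Tendsto (fun n : ℕ => (m : ℝ) / (q - 1) * q⁻¹ ^ n)
        Filter.atTop (nhds 0) := by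
      simpa using (tendsto_pow_atTop_nhds_zero_of_lt_one (inv_nonneg.2 hq0.le)
        (inv_lt_one_of_one_lt₀ hq)).const_mul ((m : ℝ) / (q - 1))
    refine squeeze_zero (fun n => div_nonneg (r_mem n).1 (by positivity)) (fun n => ?_) hgeom
    rw [inv_pow, ← div_eq_mul_inv]
    exact div_le_div_of_nonneg_right (r_mem n).2 (by positivity)
  refine ⟨fun i => digit (r i), fun i => digit_le _ (r_mem i), ?_⟩
  have hsum : HasSum (fun i => (digit (r i) : ℝ) / q ^ (i + 1)) y := by
    rw [hasSum_iff_tendsto_nat_of_nonneg (fun i => by positivity)]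
    simp_rw [partial_sum]
    simpa using r_tendsto.const_sub y
  exact hsum.tsum_eq.symm

theorem Uq'.digit_le {m : ℕ} {q : ℝ} {c : ℕ → ℕ} (hc : c ∈ Uq' m q) (i : ℕ) : c i ≤ m :=
  hc.1.1 i

theorem Uq'.eq_of_digitValue_eq {m : ℕ} {q : ℝ} {c e : ℕ → ℕ} (hc : c ∈ Uq' m q)
    (he : ∀ i, e i ≤ m) (h : digitValue q c = digitValue q e) : e = c :=
  hc.2 e ⟨he, h⟩

theorem consDigit_le {m a : ℕ} (ha : a ≤ m) {e : ℕ → ℕ} (he : ∀ i, e i ≤ m) (i : ℕ) :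
    consDigit a e i ≤ m := by
  cases i with
  | zero => exact ha
  | succ i => exact he i

theorem digitValue_consDigit {m : ℕ} {q : ℝ} (hq : 1 < q) {a : ℕ} (ha : a ≤ m) {e : ℕ → ℕ}
    (he : ∀ i, e i ≤ m) :
    digitValue q (consDigit a e) = ((a : ℝ) + digitValue q e) / q :=
  digitValue_eq_head_add_tail (m := m) (c := consDigit a e) hq (consDigit_le ha he)

theorem Uq'.tail_mem {m : ℕ} {q : ℝ} (hq : 1 < q) {c : ℕ → ℕ} (hc : c ∈ Uq' m q) :
    (fun i => c (i + 1)) ∈ Uq' m q := by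
  refine ⟨⟨fun i => Uq'.digit_le hc _, rfl⟩, fun e he => ?_⟩
  have hval : digitValue q (fun i => c (i + 1)) = digitValue q e := he.2
  have := Uq'.eq_of_digitValue_eq hc (consDigit_le (Uq'.digit_le hc 0) he.1) (by
    rw [digitValue_consDigit hq (Uq'.digit_le hc 0) he.1,
      digitValue_eq_head_add_tail hq (Uq'.digit_le hc), hval])
  funext i
  exact congrFun this (i + 1)

/-- After a nonzero digit, the tail of a unique expansion has a large value: otherwise that
digit could be lowered by one and the tail replaced by an expansion of its value plus one. -/
theorem Uq'.lt_digitValue_tail {m : ℕ} {q : ℝ} (hq : 1 < q) (hqm : q ≤ m + 1) {c : ℕ → ℕ}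
    (hc : c ∈ Uq' m q) (h0 : 0 < c 0) :
    (m : ℝ) / (q - 1) - 1 < digitValue q (fun i => c (i + 1)) := by
  by_contra! h
  obtain ⟨e, he, hval⟩ := exists_isExpansion (m := m) (q := q)
    (y := digitValue q (fun i => c (i + 1)) + 1) hq hqm
    ⟨by linarith [digitValue_nonneg hq fun i => c (i + 1)], by linarith⟩
  change _ = digitValue q e at hval
  have hpred : c 0 - 1 ≤ m := (Nat.sub_le _ _).trans (Uq'.digit_le hc 0)
  have := Uq'.eq_of_digitValue_eq hc (consDigit_le hpred he) (by
    rw [digitValue_consDigit hq hpred he, digitValue_eq_head_add_tail hq (Uq'.digit_le hc),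
      ← hval, Nat.cast_sub h0]
    push_cast
    ring)
  have h1 : c 0 - 1 = c 0 := congrFun this 0
  omega

theorem Uq'.digitValue_tail_tail_pos {m : ℕ} {q : ℝ} (hq : 1 < q) (hqm : q ≤ m + 1)
    {c : ℕ → ℕ} (hc : c ∈ Uq' m q) (h0 : 0 < c 0) :
    0 < digitValue q (fun i => c (i + 2)) := by
  have hτ : 0 ≤ (m : ℝ) / (q - 1) - 1 := by
    rw [sub_nonneg, le_div_iff₀ (by linarith)]
    linarith
  have htail := Uq'.tail_mem hq hc
  rcases Nat.eq_zero_or_pos (c 1) with h1 | h1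
  · have h2 := Uq'.lt_digitValue_tail hq hqm hc h0
    rw [digitValue_eq_head_add_tail hq (Uq'.digit_le htail)] at h2
    simp only [zero_add, h1, Nat.cast_zero] at h2
    exact (div_pos_iff_of_pos_right (by linarith)).1 (hτ.trans_lt h2)
  · exact hτ.trans_lt (Uq'.lt_digitValue_tail hq hqm htail h1)

theorem fcd_pos_iff {m : ℕ} {q : ℝ} (hq : 1 < q) {c d : ℕ → ℕ} (hc : ∀ i, c i ≤ m)
    (hd : ∀ i, d i ≤ m) :
    0 < fcd m c d q ↔ (m : ℝ) / (q - 1) - 1 < digitValue q c + digitValue q d := by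
  have hq0 : 0 < q := by linarith
  have hq1 : q - 1 ≠ 0 := by linarith
  have hsum : ∑' i : ℕ, ((c i : ℝ) + (d i : ℝ)) / q ^ (i + 2)
      = (digitValue q c + digitValue q d) / q := by
    unfold digitValue
    rw [← (summable_digits hq hc).tsum_add (summable_digits hq hd), ← tsum_div_const]
    refine tsum_congr fun i => ?_
    rw [← add_div, div_div, ← pow_succ]
  have hf : fcd m c d q
      = (digitValue q c + digitValue q d - ((m : ℝ) / (q - 1) - 1)) / q := by
    rw [fcd, hsum]
    field_simp
    ring
  rw [hf, div_pos_iff_of_pos_right hq0, sub_pos]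

/-- The case where one of the two first digits vanishes. -/
theorem lt_digitValue_add_of_head_eq_zero {k m : ℕ} (hk : 2 ≤ k) (hm : m = 2 * k + 1) {q : ℝ}
    (hkq : (k : ℝ) + 1 < q) (hqm : q ≤ (m : ℝ) + 1)
    (hpoly : 0 ≤ q ^ 3 - ((k : ℝ) + 2) * q ^ 2 + q - ((k : ℝ) + 1))
    {c d : ℕ → ℕ} (hc : c ∈ Uq' m q) (hd : d ∈ Uq' m q) (hc0 : c 0 = 0)
    (h0 : k ≤ d 0) (h1 : k + 1 ≤ d 0 ∨ k + 1 ≤ c 1 + d 1) :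
    (m : ℝ) / (q - 1) - 1 < digitValue q c + digitValue q d := by
  have hkR : (2 : ℝ) ≤ k := by exact_mod_cast hk
  have hmR : (m : ℝ) = 2 * k + 1 := by exact_mod_cast hm
  have hq : 1 < q := by linarith
  have hq0 : 0 < q := by linarith
  have hq1 : 0 < q - 1 := by linarith
  have hd0 : 0 < d 0 := by omega
  have hτ : ((m : ℝ) / (q - 1) - 1) * (q - 1) = 2 * k + 2 - q := by
    rw [hmR]
    field_simp
    ring
  rcases h1 with h1 | h1
  · have htail := Uq'.lt_digitValue_tail hq hqm hd hd0
    have hhead : (k : ℝ) + 1 ≤ d 0 := by exact_mod_cast h1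
    rw [digitValue_eq_head_add_tail hq (Uq'.digit_le hd)]
    have hdiv : (m : ℝ) / (q - 1) - 1 < ((d 0 : ℝ) + digitValue q fun i => d (i + 1)) / q := by
      rw [lt_div_iff₀ hq0]
      nlinarith
    linarith [digitValue_nonneg hq c]
  · have hpos := Uq'.digitValue_tail_tail_pos hq hqm hd hd0
    have hnonneg := digitValue_nonneg hq fun i => c (i + 2)
    have hfst : (k : ℝ) ≤ d 0 := by exact_mod_cast h0
    have hsnd : (k : ℝ) + 1 ≤ c 1 + d 1 := by exact_mod_cast h1
    have hmain : (m : ℝ) / (q - 1) - 1 ≤ (k + (k + 1) / q) / q := by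
      rw [← mul_le_mul_iff_of_pos_right hq1, hτ, ← sub_nonneg]
      have : (k + (k + 1) / q) / q * (q - 1) - (2 * k + 2 - q)
          = (q ^ 3 - ((k : ℝ) + 2) * q ^ 2 + q - ((k : ℝ) + 1)) / q ^ 2 := by
        field_simp
        ring
      rw [this]
      positivity
    rw [digitValue_eq_head_add_tail hq (Uq'.digit_le hc),
      digitValue_eq_head_add_tail hq (Uq'.digit_le hd),
      digitValue_eq_head_add_tail hq (Uq'.digit_le (Uq'.tail_mem hq hc)),
      digitValue_eq_head_add_tail hq (Uq'.digit_le (Uq'.tail_mem hq hd))]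
    simp only [zero_add, hc0, Nat.cast_zero, add_assoc, Nat.reduceAdd]
    refine hmain.trans_lt ?_
    rw [← add_div, div_lt_div_iff_of_pos_right hq0]
    have : (k + 1) / q < (c 1 + digitValue q fun i => c (i + 2)) / q
        + (d 1 + digitValue q fun i => d (i + 2)) / q := by
      rw [← add_div, div_lt_div_iff_of_pos_right hq0]
      linarith
    linarith

theorem lt_of_cubic_root {k : ℝ} (hk : 2 ≤ k) {x : ℝ}
    (hroot : x ^ 3 - (k + 2) * x ^ 2 + x - (k + 1) = 0) : k + 1 < x := by
  by_contra! h
  nlinarith [mul_nonneg (sq_nonneg x) (sub_nonneg.2 h), sq_nonneg x, sq_nonneg (x - 1)]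

theorem cubic_nonneg {k : ℝ} (hk : 2 ≤ k) {x q : ℝ}
    (hroot : x ^ 3 - (k + 2) * x ^ 2 + x - (k + 1) = 0) (hxq : x ≤ q) :
    0 ≤ q ^ 3 - (k + 2) * q ^ 2 + q - (k + 1) := by
  have hx := lt_of_cubic_root hk hroot
  have hfactor : q ^ 3 - (k + 2) * q ^ 2 + q - (k + 1)
      = (q - x) * (q * (q + x - (k + 2)) + x * (x - (k + 2)) + 1) := by
    linear_combination hroot
  rw [hfactor]
  refine mul_nonneg (by linarith) ?_
  nlinarith [mul_nonneg (sub_nonneg.2 hxq) (sub_nonneg.2 hx.le)]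

/-- For odd `m = 2k+1`, `k ≥ 2`: if `c + d ≥ k(k+1)0^∞`
lexicographically, then `f_{c,d}(q) > 0` for all `q ∈ [q_f(m), m+1]`. -/
theorem stmt19 (k m : ℕ) (hk : 2 ≤ k) (hm : m = 2 * k + 1) (qf : ℝ)
    (hqf : qf ^ 3 - ((k : ℝ) + 2) * qf ^ 2 + qf - ((k : ℝ) + 1) = 0)
    (hqf' : ∀ y : ℝ, y ^ 3 - ((k : ℝ) + 2) * y ^ 2 + y - ((k : ℝ) + 1) = 0 → y ≤ qf)
    (q : ℝ) (hq : q ∈ Set.Icc qf ((m : ℝ) + 1))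
    (c d : ℕ → ℕ) (hc : c ∈ Aq' m q) (hd : d ∈ Aq' m q)
    (hge : lexLe (fun i => if i = 0 then k else if i = 1 then k + 1 else 0)
      (fun i => c i + d i)) :
    0 < fcd m c d q := by
  have hkR : (2 : ℝ) ≤ k := by exact_mod_cast hk
  have hmR : (m : ℝ) = 2 * k + 1 := by exact_mod_cast hm
  have hkq : (k : ℝ) + 1 < q := (lt_of_cubic_root hkR hqf).trans_le hq.1
  have hq1 : 1 < q := by linarith
  have hpoly := cubic_nonneg hkR hqf hq.1
  have hcU := hc.1
  have hdU := hd.1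
  rw [fcd_pos_iff hq1 (Uq'.digit_le hcU) (Uq'.digit_le hdU)]
  have hdigits : k ≤ c 0 + d 0 ∧ (k + 1 ≤ c 0 + d 0 ∨ k + 1 ≤ c 1 + d 1) := by
    rcases hge with ⟨n, heq, hlt⟩ | heq
    · rcases n with _ | _ | n
      · simp only [if_true] at hlt
        omega
      · have h0 := heq 0 (by omega)
        simp at h0 hlt
        omega
      · have h0 := heq 0 (by omega)
        have h1 := heq 1 (by omega)
        simp at h0 h1
        omega
    · have h0 := congrFun heq 0
      have h1 := congrFun heq 1
      simp at h0 h1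
      omega
  obtain ⟨h0, h1⟩ := hdigits
  rcases Nat.eq_zero_or_pos (c 0) with hc0 | hc0
  · exact lt_digitValue_add_of_head_eq_zero hk hm hkq hq.2 hpoly hcU hdU hc0
      (by omega) (by omega)
  rcases Nat.eq_zero_or_pos (d 0) with hd0 | hd0
  · rw [add_comm (digitValue q c)]
    exact lt_digitValue_add_of_head_eq_zero hk hm hkq hq.2 hpoly hdU hcU hd0
      (by omega) (by omega)
  have hctail := Uq'.lt_digitValue_tail hq1 hq.2 hcU hc0
  have hdtail := Uq'.lt_digitValue_tail hq1 hq.2 hdU hd0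
  have hhead : (k : ℝ) ≤ c 0 + d 0 := by exact_mod_cast h0
  have hτ : ((m : ℝ) / (q - 1) - 1) * (q - 1) = 2 * k + 2 - q := by
    have : q - 1 ≠ 0 := by linarith
    rw [hmR]
    field_simp
    ring
  have hquad : 2 * k + 2 - q - k ≤ (m : ℝ) / (q - 1) - 1 := by
    rw [hmR, le_sub_iff_add_le, le_div_iff₀ (by linarith)]
    nlinarith
  rw [digitValue_eq_head_add_tail hq1 (Uq'.digit_le hcU),
    digitValue_eq_head_add_tail hq1 (Uq'.digit_le hdU), ← add_div, lt_div_iff₀ (by linarith)]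
  linarith
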